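/- If a nonempty polyhedron P = {z ∈ ℝ^d : Cz ≤ b} with rational C and b has facet complexity φ (every inequality has encoding length at most φ), then P contains a point in its relative interior whose encoding length is bounded by a polynomial in d and φ. -/

import Mathlib

/-- Encoding length of a rational number `p/q` in lowest terms:
`⌈log₂(|p|+1)⌉ + ⌈log₂(|q|+1)⌉ + 2`. -/
def encLen (x : ℚ) : ℕ :=
  Nat.clog 2 (x.num.natAbs + 1) + Nat.clog 2 (x.den + 1) + 2


section helpers

open Finset

/-- Existence of a vertex for a pointed polyhedron. -/
theorem exists_vertex {E ι : Type*} [AddCommGroup E] [Module ℝ E] [Fintype ι]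
    (a : ι → E →ₗ[ℝ] ℝ) (b : ι → ℝ) (hp : ∀ y, (∀ i, a i y = 0) → y = 0)
    (hne : ∃ x, ∀ i, a i x ≤ b i) :
    ∃ x, (∀ i, a i x ≤ b i) ∧ ∀ y, (∀ i, a i x = b i → a i y = 0) → y = 0 := by
  classical
  let T : E → Finset ι := fun x => univ.filter (fun i => a i x = b i)
  obtain ⟨x, hx, hmin⟩ := WellFounded.has_min
    (measure (fun x : E => Fintype.card ι - (T x).card)).wf {x | ∀ i, a i x ≤ b i} hne
  refine ⟨x, hx, ?_⟩
  have key : ∀ y, (∀ i, a i x = b i → a i y = 0) → ∀ i0, ¬ 0 < a i0 y := by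
    intro y hy i0 hi0
    obtain ⟨i1, hi1, hle⟩ := Finset.exists_min_image (univ.filter (fun i => 0 < a i y))
      (fun i => (b i - a i x) / a i y) ⟨i0, by simpa using hi0⟩
    have hi1p : 0 < a i1 y := by simpa using hi1
    set t := (b i1 - a i1 x) / a i1 y with ht
    have ht0 : 0 ≤ t := div_nonneg (sub_nonneg.2 (hx i1)) hi1p.le
    have hfeas : ∀ i, a i (x + t • y) ≤ b i := by
      intro i
      simp only [map_add, map_smul, smul_eq_mul]
      rcases le_or_gt (a i y) 0 with h | h
      · have := mul_nonneg_of_nonpos_of_nonpos (neg_nonpos.2 ht0) h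
        linarith [hx i]
      · have := hle i (by simpa using h)
        rw [le_div_iff₀ h] at this
        linarith
    have hlt : (T x).card < (T (x + t • y)).card := by
      apply Finset.card_lt_card
      refine (Finset.ssubset_iff_of_subset ?_).2 ⟨i1, ?_, ?_⟩
      · intro i hi
        have hi' : a i x = b i := by simpa [T] using hi
        simp [T, hi', hy i hi']
      · have : t * a i1 y = b i1 - a i1 x := by rw [ht]; field_simp
        simp [T, this]
      · intro hi
        have hi' : a i1 x = b i1 := by simpa [T] using hi
        exact hi1p.ne' (hy i1 hi')
    have hc : (T (x + t • y)).card ≤ Fintype.card ι := Finset.card_le_univ _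
    apply hmin (x + t • y) hfeas
    show Fintype.card ι - _ < Fintype.card ι - _
    omega
  intro y hy
  apply hp
  intro i
  have h1 := key y hy i
  have h2 := key (-y) (fun i hi => by simp [hy i hi]) i
  simp only [map_neg] at h2
  linarith

theorem exists_small_solution {ι κ : Type*} [Fintype ι] [Fintype κ] [DecidableEq κ]
    (A : ι → κ → ℤ) (r : ι → ℤ) (M : ℕ) (hM : 1 ≤ M)
    (hA : ∀ i j, |A i j| ≤ M) (hr : ∀ i, |r i| ≤ M)
    (hne : ∃ x : κ → ℝ, ∀ i, ∑ j, (A i j : ℝ) * x j ≤ r i) :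
    ∃ (N : ℤ) (p : κ → ℤ), N ≠ 0 ∧ (∀ j, |p j| ≤ (Fintype.card κ).factorial * M ^ Fintype.card κ) ∧
      ∀ i, ∑ j, (A i j : ℝ) * ((p j : ℝ) / N) ≤ r i := by
  classical
  obtain ⟨x0, hx0⟩ := hne
  let σ : κ → ℤ := fun j => if x0 j ≤ 0 then 1 else -1
  let A' : ι ⊕ κ → κ → ℤ := Sum.elim A (fun j => Pi.single j (σ j))
  let r' : ι ⊕ κ → ℤ := Sum.elim r (fun _ => 0)
  have hσ : ∀ j, |σ j| = 1 := by intro j; by_cases h : x0 j ≤ 0 <;> simp [σ, h]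
  have hσ0 : ∀ j, (σ j : ℝ) ≠ 0 := by intro j; by_cases h : x0 j ≤ 0 <;> simp [σ, h]
  have hA' : ∀ i j, |A' i j| ≤ M := by
    rintro (i | i) j
    · exact hA i j
    · by_cases h : j = i
      · subst h; simp [A', hσ]; exact_mod_cast hM
      · simp [A', h]
  have hr' : ∀ i, |r' i| ≤ M := by
    rintro (i | i)
    · exact hr i
    · simp [r']
  let a : ι ⊕ κ → (κ → ℝ) →ₗ[ℝ] ℝ := fun i => ∑ j, (A' i j : ℝ) • LinearMap.proj j
  have ha : ∀ i x, a i x = ∑ j, (A' i j : ℝ) * x j := by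
    intro i x; simp [a, LinearMap.sum_apply]
  have haκ : ∀ j x, a (Sum.inr j) x = σ j * x j := by
    intro j x
    rw [ha, Finset.sum_eq_single j]
    · simp [A']
    · intro l _ h; simp [A', h]
    · simp
  obtain ⟨x, hx, hxv⟩ := exists_vertex a (fun i => (r' i : ℝ))
    (by
      intro y hy
      ext j
      have := hy (Sum.inr j)
      rw [haκ] at this
      simpa [hσ0 j] using this)
    ⟨x0, by
      rintro (i | j)
      · rw [ha]; exact hx0 i
      · rw [haκ]
        by_cases h : x0 j ≤ 0
        · simpa [σ, h, r'] using h
        · simp [σ, h, r']; linarith⟩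
  -- tight rows
  let R := {i // a i x = (r' i : ℝ)}
  let v : R → (κ → ℝ) := fun i j => (A' i.1 j : ℝ)
  have hspan : Submodule.span ℝ (Set.range v) = ⊤ := by
    by_contra hne
    obtain ⟨f, hf0, hf⟩ := Submodule.exists_le_ker_of_lt_top _ (lt_top_iff_ne_top.2 hne)
    apply hf0
    have hfy : ∀ w : κ → ℝ, f w = ∑ j, w j * f (Pi.single j 1) := by
      intro w
      conv_lhs => rw [pi_eq_sum_univ' w]
      simp [map_sum]
    have hy : (fun j => f (Pi.single j 1)) = 0 := by
      apply hxv
      intro i hi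
      have : f (v ⟨i, hi⟩) = 0 := hf (Submodule.subset_span ⟨⟨i, hi⟩, rfl⟩)
      rw [hfy] at this
      rw [ha]; exact this
    ext w
    have := congrFun hy w
    simpa using this
  obtain ⟨κ', e, -, hsp, hli⟩ := exists_linearIndependent' ℝ v
  rw [hspan] at hsp
  let bas := Module.Basis.mk hli hsp.ge
  let eq : κ ≃ κ' := (Pi.basisFun ℝ κ).indexEquiv bas
  let B : Matrix κ κ ℤ := Matrix.of fun i j => A' (e (eq i)).1 j
  let rb : κ → ℤ := fun i => r' (e (eq i)).1
  let BR : Matrix κ κ ℝ := B.map (fun z : ℤ => (z : ℝ))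
  have hBR : BR.det = (B.det : ℝ) := by
    have := RingHom.map_det (Int.castRingHom ℝ) B
    simpa [BR] using this.symm
  have hli2 : LinearIndependent ℝ BR.row := by
    have := hli.comp eq eq.injective
    exact this
  have hdet : B.det ≠ 0 := by
    have h1 := Matrix.linearIndependent_rows_iff_isUnit.1 hli2
    rw [Matrix.isUnit_iff_isUnit_det, hBR] at h1
    intro h
    simp [h] at h1
  have hBx : BR.mulVec x = fun i => (rb i : ℝ) := by
    ext i
    have := (e (eq i)).2
    rw [ha] at this
    exact this
  have hcr : ∀ j, (B.det : ℝ) * x j = (B.cramer rb j : ℤ) := by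
    intro j
    have h1 : BR.cramer (fun i => (rb i : ℝ)) = BR.det • x := by
      rw [← hBx, Matrix.cramer_eq_adjugate_mulVec, Matrix.mulVec_mulVec, Matrix.adjugate_mul,
        Matrix.smul_mulVec, Matrix.one_mulVec]
    have h2 := congrFun h1 j
    rw [Matrix.cramer_apply] at h2
    have h3 : BR.updateCol j (fun i => (rb i : ℝ)) = (B.updateCol j rb).map (Int.castRingHom ℝ) := by
      ext i l
      by_cases h : l = j
      · subst h; simp
      · simp [h, BR]
    rw [h3, ← RingHom.mapMatrix_apply, ← RingHom.map_det, ← Matrix.cramer_apply] at h2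
    simp [hBR] at h2
    rw [h2]
  refine ⟨B.det, B.cramer rb, hdet, ?_, ?_⟩
  · intro j
    rw [Matrix.cramer_apply]
    have := Matrix.det_le (A := B.updateCol j rb) (abv := AbsoluteValue.abs) (x := (M : ℤ)) (by
      intro i l
      by_cases h : l = j
      · subst h; simpa using hr' _
      · simpa [h, B] using hA' (e (eq i)).1 l)
    simpa using this
  · intro i
    have h := hx (Sum.inl i)
    rw [ha] at h
    have hxj : ∀ j, ((B.cramer rb j : ℤ) : ℝ) / (B.det : ℝ) = x j := by
      intro j
      rw [← hcr, mul_div_cancel_left₀]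
      exact_mod_cast hdet
    simp only [hxj]
    exact h

theorem scale_row {κ : Type*} [Fintype κ] [DecidableEq κ] (q : κ → ℚ) :
    ∃ (D : ℕ) (c : κ → ℤ), 0 < D ∧ (∀ o, (c o : ℚ) = D * q o) ∧
      ∀ o, |c o| ≤ ((2 ^ (∑ o, encLen (q o)) : ℕ) : ℤ) := by
  refine ⟨∏ o, (q o).den, fun o => (q o).num * ((∏ o' ∈ univ.erase o, (q o').den : ℕ) : ℤ),
    Finset.prod_pos (fun o _ => (q o).den_pos), ?_, ?_⟩
  · intro o
    rw [← Finset.mul_prod_erase univ _ (mem_univ o)]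
    have := Rat.mul_den_eq_num (q o)
    push_cast
    rw [← this]; ring
  · intro o
    have h1 : ∀ o, (q o).den ≤ 2 ^ encLen (q o) := by
      intro o
      have := Nat.le_pow_clog (b := 2) (by norm_num) ((q o).den + 1)
      calc (q o).den ≤ 2 ^ Nat.clog 2 ((q o).den + 1) := by omega
        _ ≤ _ := Nat.pow_le_pow_right (by norm_num) (by unfold encLen; omega)
    have h2 : (q o).num.natAbs ≤ 2 ^ encLen (q o) := by
      have := Nat.le_pow_clog (b := 2) (by norm_num) ((q o).num.natAbs + 1)
      calc (q o).num.natAbs ≤ 2 ^ Nat.clog 2 ((q o).num.natAbs + 1) := by omega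
        _ ≤ _ := Nat.pow_le_pow_right (by norm_num) (by unfold encLen; omega)
    rw [Int.abs_eq_natAbs, Nat.cast_le, Int.natAbs_mul, Int.natAbs_natCast,
      ← Finset.prod_pow_eq_pow_sum, ← Finset.mul_prod_erase univ _ (mem_univ o)]
    exact Nat.mul_le_mul h2 (Finset.prod_le_prod' (fun i _ => h1 i))

theorem mem_relint {d k : ℕ} (c : Fin k → Fin d → ℝ) (b : Fin k → ℝ) (z : Fin d → ℝ)
    (hz : ∀ i, (∑ j, c i j * z j) ≤ b i)
    (hs : ∀ i, (∃ w : Fin d → ℝ, (∀ i, ∑ j, c i j * w j ≤ b i) ∧ ∑ j, c i j * w j < b i) →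
      ∑ j, c i j * z j < b i) :
    z ∈ intrinsicInterior ℝ {z : Fin d → ℝ | ∀ i, (∑ j, c i j * z j) ≤ b i} := by
  set P := {z : Fin d → ℝ | ∀ i, (∑ j, c i j * z j) ≤ b i} with hP
  rw [mem_intrinsicInterior]
  refine ⟨⟨z, subset_affineSpan ℝ P hz⟩, ?_, rfl⟩
  rw [mem_interior]
  refine ⟨{w | ∀ i, (∃ w : Fin d → ℝ, (∀ i, ∑ j, c i j * w j ≤ b i) ∧ ∑ j, c i j * w j < b i) →
      ∑ j, c i j * (w : Fin d → ℝ) j < b i}, ?_, ?_, hs⟩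
  · rintro ⟨w, hw⟩ hw'
    show w ∈ P
    intro i
    by_cases h : ∃ w : Fin d → ℝ, (∀ i, ∑ j, c i j * w j ≤ b i) ∧ ∑ j, c i j * w j < b i
    · exact (hw' i h).le
    · push Not at h
      apply le_of_eq
      refine affineSpan_induction (p := fun w => ∑ j, c i j * w j = b i) hw ?_ ?_
      · intro x hx
        exact le_antisymm (hx i) (h x hx)
      · intro t u v w hu hv hw
        have : ∑ j, c i j * (t • (u -ᵥ v) +ᵥ w) j =
            t * (∑ j, c i j * u j - ∑ j, c i j * v j) + ∑ j, c i j * w j := by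
          rw [← Finset.sum_sub_distrib, Finset.mul_sum, ← Finset.sum_add_distrib]
          refine Finset.sum_congr rfl fun j _ => ?_
          simp
          ring
        rw [this, hu, hv, hw]; ring
  · simp only [Set.ofPred_forall]
    refine isOpen_iInter_of_finite fun i => isOpen_iInter_of_finite fun _ => ?_
    refine isOpen_lt ?_ continuous_const
    refine continuous_finsetSum _ fun j _ => ?_
    exact continuous_const.mul ((continuous_apply j).comp continuous_subtype_val)

theorem exists_uniform_slack {d k : ℕ} (c : Fin k → Fin d → ℝ) (b : Fin k → ℝ)
    (hne : ∃ z : Fin d → ℝ, ∀ i, (∑ j, c i j * z j) ≤ b i) :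
    ∃ (z : Fin d → ℝ), (∀ i, (∑ j, c i j * z j) ≤ b i) ∧
    (∀ i, (∃ w : Fin d → ℝ, (∀ i, ∑ j, c i j * w j ≤ b i) ∧ ∑ j, c i j * w j < b i) →
      ∑ j, c i j * z j < b i) := by
  have H : ∀ s : Finset (Fin k), ∃ (z : Fin d → ℝ), (∀ i, (∑ j, c i j * z j) ≤ b i) ∧
    (∀ i ∈ s, (∃ w : Fin d → ℝ, (∀ i, ∑ j, c i j * w j ≤ b i) ∧ ∑ j, c i j * w j < b i) →
      ∑ j, c i j * z j < b i) := by
    intro s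
    induction s using Finset.induction_on with
    | empty => obtain ⟨z, hz⟩ := hne; exact ⟨z, hz, by simp⟩
    | insert i0 s hi ih =>
      obtain ⟨z, hz, hs⟩ := ih
      by_cases h : ∃ w : Fin d → ℝ, (∀ i, ∑ j, c i j * w j ≤ b i) ∧ ∑ j, c i0 j * w j < b i0
      · obtain ⟨w, hw, hw0⟩ := h
        have e : ∀ i, ∑ j, c i j * ((z j + w j) / 2) =
            (∑ j, c i j * z j + ∑ j, c i j * w j) / 2 := by
          intro i
          rw [← Finset.sum_add_distrib, Finset.sum_div]
          exact Finset.sum_congr rfl fun j _ => by ring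
        refine ⟨fun j => (z j + w j) / 2, fun i => ?_, fun i hi h => ?_⟩
        · rw [e]; linarith [hz i, hw i]
        · rw [e]
          rcases Finset.mem_insert.1 hi with rfl | hi
          · linarith [hz i]
          · linarith [hs i hi h, hw i]
      · refine ⟨z, hz, fun i hi h' => ?_⟩
        rcases Finset.mem_insert.1 hi with rfl | hi
        · exact absurd h' h
        · exact hs i hi h'
  obtain ⟨z, hz, hs⟩ := H univ
  exact ⟨z, hz, fun i => hs i (mem_univ i)⟩

theorem encLen_div_le (p q : ℤ) (L : ℕ) (hq0 : q ≠ 0) (hp : p.natAbs + 1 ≤ 2 ^ L)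
    (hq : q.natAbs + 1 ≤ 2 ^ L) : encLen ((p : ℚ) / q) ≤ 2 * L + 2 := by
  have h1 : ((p : ℚ) / q).num.natAbs ≤ p.natAbs := by
    by_cases h : p = 0
    · simp [h]
    · apply Nat.le_of_dvd (Int.natAbs_pos.2 h)
      rw [Int.natAbs_dvd_natAbs, ← Rat.divInt_eq_div]
      exact Rat.num_dvd p hq0
  have h2 : ((p : ℚ) / q).den ≤ q.natAbs := by
    apply Nat.le_of_dvd (Int.natAbs_pos.2 hq0)
    rw [← Int.natCast_dvd, ← Rat.divInt_eq_div]
    exact Rat.den_dvd p q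
  have h3 := (Nat.clog_le_iff_le_pow (b := 2) (by norm_num)
    (x := ((p : ℚ) / q).num.natAbs + 1) (y := L)).2 (by omega)
  have h4 := (Nat.clog_le_iff_le_pow (b := 2) (by norm_num)
    (x := ((p : ℚ) / q).den + 1) (y := L)).2 (by omega)
  unfold encLen
  omega

end helpers

/-- A nonempty rational polyhedron `P = {z : Cz ≤ b}` of facet complexity `φ` (every
inequality has encoding length at most `φ`) contains a point in its relative interior whose
encoding length is bounded by a polynomial in `d` and `φ`. -/
theorem relint_point_of_polynomial_encoding_length :
    ∃ poly : Polynomial ℕ, ∀ (d k : ℕ) (C : Matrix (Fin k) (Fin d) ℚ) (b : Fin k → ℚ)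
      (φ : ℕ),
      (∀ i : Fin k, (∑ j, encLen (C i j)) + encLen (b i) ≤ φ) →
      ({z : Fin d → ℝ | ∀ i, (∑ j, (C i j : ℝ) * z j) ≤ (b i : ℝ)}).Nonempty →
      ∃ z : Fin d → ℚ,
        (fun j => (z j : ℝ)) ∈
          intrinsicInterior ℝ {z : Fin d → ℝ | ∀ i, (∑ j, (C i j : ℝ) * z j) ≤ (b i : ℝ)} ∧
        (∑ j, encLen (z j)) ≤ poly.eval (d + φ) := by
  classical
  refine ⟨Polynomial.X * (2 * ((Polynomial.X + 1) ^ 2 + 1) + 2), ?_⟩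
  intro d k C b φ hφ hne
  choose D c hD hc hcb using fun i : Fin k =>
    scale_row (fun o : Option (Fin d) => Option.elim o (b i) (C i))
  have hM : ∀ i o, |c i o| ≤ ((2 ^ φ : ℕ) : ℤ) := by
    intro i o
    refine (hcb i o).trans ?_
    have h := hφ i
    rw [Nat.cast_le]
    apply Nat.pow_le_pow_right (by norm_num)
    rw [Fintype.sum_option]
    simp only [Option.elim]
    omega
  have hDr : ∀ i, (0 : ℝ) < D i := fun i => by exact_mod_cast hD i
  have hcs : ∀ i j, (c i (some j) : ℝ) = D i * (C i j : ℝ) := by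
    intro i j
    have := hc i (some j)
    simp only [Option.elim] at this
    exact_mod_cast this
  have hcn : ∀ i, (c i none : ℝ) = D i * (b i : ℝ) := by
    intro i
    have := hc i none
    simp only [Option.elim] at this
    exact_mod_cast this
  have hsum : ∀ i (x : Fin d → ℝ), ∑ j, (c i (some j) : ℝ) * x j = D i * ∑ j, (C i j : ℝ) * x j := by
    intro i x
    rw [Finset.mul_sum]
    exact Finset.sum_congr rfl fun j _ => by rw [hcs]; ring
  -- the strict constraints
  let S : Fin k → Prop := fun i => ∃ w : Fin d → ℝ,
    (∀ i, ∑ j, (C i j : ℝ) * w j ≤ (b i : ℝ)) ∧ ∑ j, (C i j : ℝ) * w j < (b i : ℝ)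
  obtain ⟨z0, hz0, hz0s⟩ := exists_uniform_slack (fun i j => (C i j : ℝ)) (fun i => (b i : ℝ)) hne
  have hz0e : ∀ i, ¬ S i → ∑ j, (C i j : ℝ) * z0 j = b i := by
    intro i hi
    refine le_antisymm (hz0 i) ?_
    by_contra h
    exact hi ⟨z0, hz0, not_le.1 h⟩
  -- homogenized system
  let h : Fin k → Option (Fin d) → ℤ := fun i o => Option.elim o (-(c i none)) (fun j => c i (some j))
  have hh : ∀ i o, |h i o| ≤ ((2 ^ φ : ℕ) : ℤ) := by
    rintro i (_ | j)
    · simpa [h] using hM i none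
    · exact hM i (some j)
  have hhs : ∀ i (x : Option (Fin d) → ℝ), ∑ o, (h i o : ℝ) * x o =
      D i * (∑ j, (C i j : ℝ) * x (some j) - b i * x none) := by
    intro i x
    rw [Fintype.sum_option]
    simp only [h, Option.elim]
    rw [hsum]
    push_cast
    rw [hcn]
    ring
  let A : Fin k ⊕ Fin k ⊕ Unit → Option (Fin d) → ℤ :=
    Sum.elim h (Sum.elim (fun i o => if S i then 0 else - h i o)
      (fun _ o => Option.elim o (-1) (fun _ => 0)))
  let r : Fin k ⊕ Fin k ⊕ Unit → ℤ :=
    Sum.elim (fun i => if S i then -1 else 0) (Sum.elim (fun _ => 0) (fun _ => -1))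
  have h1M : (1 : ℤ) ≤ ((2 ^ φ : ℕ) : ℤ) := by exact_mod_cast Nat.one_le_two_pow
  have hA2 : ∀ i, ¬ S i → ∀ x : Option (Fin d) → ℝ,
      ∑ o, (A (Sum.inr (Sum.inl i)) o : ℝ) * x o = - ∑ o, (h i o : ℝ) * x o := by
    intro i hi x
    rw [← Finset.sum_neg_distrib]
    exact Finset.sum_congr rfl fun o _ => by simp [A, hi]
  have hA3 : ∀ x : Option (Fin d) → ℝ,
      ∑ o, (A (Sum.inr (Sum.inr ())) o : ℝ) * x o = - x none := by
    intro x
    rw [Fintype.sum_option]; simp [A]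
  obtain ⟨N, p, hN, hp, hfeas⟩ := exists_small_solution A r (2 ^ φ) Nat.one_le_two_pow
    (by
      rintro (i | i | u) o
      · exact hh i o
      · by_cases hS : S i
        · simp [A, hS]
        · simpa [A, hS] using hh i o
      · rcases o with _ | j
        · simpa [A] using h1M
        · simp [A])
    (by
      rintro (i | i | u)
      · by_cases hS : S i
        · simpa [r, hS] using h1M
        · simp [r, hS]
      · simp [r]
      · simpa [r] using h1M)
    (by
      -- large scaling factor
      have : ∃ s : ℝ, 1 ≤ s ∧ ∀ i, S i → 1 ≤ s * (D i * (b i - ∑ j, (C i j : ℝ) * z0 j)) := by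
        let f : Fin k → ℝ := fun i => |1 / (D i * (b i - ∑ j, (C i j : ℝ) * z0 j))|
        refine ⟨1 + ∑ i, f i, ?_, ?_⟩
        · have : 0 ≤ ∑ i, f i := Finset.sum_nonneg fun i _ => abs_nonneg _
          linarith
        · intro i hi
          have hpos : 0 < D i * (b i - ∑ j, (C i j : ℝ) * z0 j) :=
            mul_pos (hDr i) (sub_pos.2 (hz0s i hi))
          have h1 : f i ≤ ∑ i, f i :=
            Finset.single_le_sum (fun i _ => abs_nonneg _) (Finset.mem_univ i)
          have h2 : 1 / (D i * (b i - ∑ j, (C i j : ℝ) * z0 j)) ≤ 1 + ∑ i, f i := by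
            have := le_abs_self (1 / (D i * (b i - ∑ j, (C i j : ℝ) * z0 j)))
            simp only [f] at h1 ⊢
            linarith
          rwa [div_le_iff₀ hpos] at h2
      obtain ⟨s, hs1, hs⟩ := this
      refine ⟨fun o => Option.elim o s (fun j => s * z0 j), ?_⟩
      have hx : ∀ i, ∑ o, (h i o : ℝ) * (Option.elim o s (fun j => s * z0 j)) =
          - (s * (D i * (b i - ∑ j, (C i j : ℝ) * z0 j))) := by
        intro i
        rw [hhs]
        simp only [Option.elim]
        have : ∑ j, (C i j : ℝ) * (s * z0 j) = s * ∑ j, (C i j : ℝ) * z0 j := by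
          rw [Finset.mul_sum]; exact Finset.sum_congr rfl fun j _ => by ring
        rw [this]; ring
      rintro (i | i | u)
      · have : ∑ o, (A (Sum.inl i) o : ℝ) * (Option.elim o s (fun j => s * z0 j)) = _ := hx i
        rw [this]
        by_cases hS : S i
        · simpa [r, hS] using hs i hS
        · simp [r, hS, hz0e i hS]
      · by_cases hS : S i
        · simp [A, r, hS]
        · rw [hA2 i hS, hx, hz0e i hS]; simp [r]
      · rw [hA3]; simpa [r] using hs1)
  have hn : Fintype.card (Option (Fin d)) = d + 1 := by simp
  rw [hn] at hp
  have hNr : (N : ℝ) ≠ 0 := by exact_mod_cast hN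
  -- the last coordinate
  have hlast : (1 : ℝ) ≤ (p none : ℝ) / N := by
    have := hfeas (Sum.inr (Sum.inr ()))
    rw [hA3] at this
    simp [r] at this
    linarith
  have hp0 : p none ≠ 0 := by
    intro h0
    rw [h0] at hlast
    norm_num at hlast
  have hp0r : (p none : ℝ) ≠ 0 := by exact_mod_cast hp0
  have hzval : ∀ i, ∑ j, (C i j : ℝ) * (((p (some j) : ℚ) / (p none : ℚ) : ℚ) : ℝ) - b i =
      (∑ o, (h i o : ℝ) * ((p o : ℝ) / N)) / (D i * ((p none : ℝ) / N)) := by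
    intro i
    rw [hhs, mul_div_mul_left _ _ (hDr i).ne', sub_div, mul_div_cancel_right₀ _ (by positivity),
      Finset.sum_div]
    congr 1
    refine Finset.sum_congr rfl fun j _ => ?_
    push_cast
    field_simp
  have hden : ∀ i, 0 < D i * ((p none : ℝ) / N) := fun i => mul_pos (hDr i) (by linarith)
  have hstrict : ∀ i, S i →
      ∑ j, (C i j : ℝ) * (((p (some j) : ℚ) / (p none : ℚ) : ℚ) : ℝ) < b i := by
    intro i hi
    rw [← sub_neg, hzval]
    apply div_neg_of_neg_of_pos _ (hden i)
    have h1 : ∑ o, (h i o : ℝ) * ((p o : ℝ) / N) ≤ (r (Sum.inl i) : ℝ) := hfeas (Sum.inl i)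
    have h2 : (r (Sum.inl i) : ℝ) = -1 := by simp [r, hi]
    linarith
  have hle : ∀ i, ∑ j, (C i j : ℝ) * (((p (some j) : ℚ) / (p none : ℚ) : ℚ) : ℝ) ≤ b i := by
    intro i
    by_cases hi : S i
    · exact (hstrict i hi).le
    · rw [← sub_nonpos, hzval]
      apply div_nonpos_of_nonpos_of_nonneg _ (hden i).le
      have h1 : ∑ o, (h i o : ℝ) * ((p o : ℝ) / N) ≤ (r (Sum.inl i) : ℝ) := hfeas (Sum.inl i)
      simpa [r, hi] using h1
  refine ⟨fun j => (p (some j) : ℚ) / (p none : ℚ), ?_, ?_⟩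
  · exact mem_relint (fun i j => (C i j : ℝ)) (fun i => (b i : ℝ)) _ hle hstrict
  · have hK : (d + 1).factorial * (2 ^ φ) ^ (d + 1) + 1 ≤ 2 ^ ((d + φ + 1) ^ 2 + 1) := by
      have h1 : (d + 1).factorial ≤ (2 ^ (d + 1)) ^ (d + 1) :=
        (Nat.factorial_le_pow _).trans (Nat.pow_le_pow_left Nat.lt_two_pow_self.le _)
      have h2 : (d + 1).factorial * (2 ^ φ) ^ (d + 1) ≤ 2 ^ ((d + φ + 1) ^ 2) := by
        calc _ ≤ (2 ^ (d + 1)) ^ (d + 1) * (2 ^ φ) ^ (d + 1) := Nat.mul_le_mul_right _ h1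
          _ = 2 ^ ((d + 1 + φ) * (d + 1)) := by rw [← mul_pow, ← pow_add, ← pow_mul]
          _ ≤ _ := Nat.pow_le_pow_right (by norm_num) (by nlinarith)
      have h3 : 1 ≤ 2 ^ ((d + φ + 1) ^ 2) := Nat.one_le_two_pow
      rw [pow_succ 2 ((d + φ + 1) ^ 2)]
      omega
    have hpn : ∀ o, (p o).natAbs + 1 ≤ 2 ^ ((d + φ + 1) ^ 2 + 1) := by
      intro o
      refine le_trans ?_ hK
      have := hp o
      rw [Int.abs_eq_natAbs] at this
      have h2 : (p o).natAbs ≤ (d + 1).factorial * (2 ^ φ) ^ (d + 1) := by exact_mod_cast this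
      omega
    calc ∑ j, encLen ((p (some j) : ℚ) / (p none : ℚ))
        ≤ ∑ _j : Fin d, (2 * ((d + φ + 1) ^ 2 + 1) + 2) :=
          Finset.sum_le_sum fun j _ => encLen_div_le _ _ _ hp0 (hpn _) (hpn _)
      _ = d * (2 * ((d + φ + 1) ^ 2 + 1) + 2) := by simp
      _ ≤ (d + φ) * (2 * ((d + φ + 1) ^ 2 + 1) + 2) := Nat.mul_le_mul_right _ (by omega)
      _ = _ := by simp
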